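/- arXiv:1009.2270 — 2 statements merged into one kernel-verified Lean document; each statement's English description precedes it below -/
import Mathlib

section
/- Let I and W be databases and U a consistent set of update actions. Then (I∘U) △ W = (I △ W) ∘ T_W(U), where △ denotes symmetric difference. -/
namespace AICF

/-- Propositional literals over atoms `At`. -/
inductive Lit (At : Type*) where
  | pos : At → Lit At
  | neg : At → Lit At

namespace Lit
variable {At : Type*}

/-- The dual literal. -/
def dual : Lit At → Lit At
  | pos a => neg a
  | neg a => pos a

/-- The underlying atom of a literal. -/
def atom : Lit At → At
  | pos a => a
  | neg a => a

end Lit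

variable {At : Type*}

/-- A database `I` entails a literal. -/
def entails (I : Set At) : Lit At → Prop
  | .pos a => a ∈ I
  | .neg a => a ∉ I

/-- A database entails a set of literals if it entails each member. -/
def entailsSet (I : Set At) (S : Set (Lit At)) : Prop := ∀ L ∈ S, entails I L

/-- Update actions: `+a` (insert) and `−a` (delete). -/
inductive UAct (At : Type*) where
  | add : At → UAct At
  | del : At → UAct At

namespace UAct
variable {At : Type*}

/-- The dual update action. -/
def dual : UAct At → UAct At
  | add a => del a
  | del a => add a

/-- The underlying atom of an update action. -/
def atom : UAct At → At
  | add a => a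
  | del a => a

/-- `lit(+a) = a`, `lit(−a) = not a`. -/
def lit : UAct At → Lit At
  | add a => .pos a
  | del a => .neg a

end UAct

/-- `ua(a) = +a`, `ua(not a) = −a`. -/
def Lit.ua : Lit At → UAct At
  | .pos a => .add a
  | .neg a => .del a

/-- A set of update actions is consistent if it contains no pair `+a, −a`. -/
def consistentActs (U : Set (UAct At)) : Prop :=
  ∀ a : At, ¬ (UAct.add a ∈ U ∧ UAct.del a ∈ U)

/-- `I ∘ U = (I ∪ {a : +a ∈ U}) \ {a : −a ∈ U}`. -/
def applyActs (I : Set At) (U : Set (UAct At)) : Set At :=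
  (I ∪ {a | UAct.add a ∈ U}) \ {a | UAct.del a ∈ U}

/-- The set of no-effect actions `ne(I,R)`. -/
def noEffect (I R : Set At) : Set (UAct At) :=
  UAct.add '' (I ∩ R) ∪ UAct.del '' (I ∪ R)ᶜ

/-- An active integrity constraint: body (literals), head (update actions),
with `lit(α)^D ∈ body` for each `α` in the head. -/
structure AIC (At : Type*) where
  body : Set (Lit At)
  head : Set (UAct At)
  hua : ∀ α ∈ head, (UAct.lit α).dual ∈ body

/-- `I ⊨ r` : `I` does not entail the whole body. -/
def satAIC (I : Set At) (r : AIC At) : Prop := ¬ entailsSet I r.body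

/-- `I ⊨ η`. -/
def satAICs (I : Set At) (η : Set (AIC At)) : Prop := ∀ r ∈ η, satAIC I r

/-- The updatable literals of `r`: `lit(head(r))^D`. -/
def AIC.up (r : AIC At) : Set (Lit At) := (fun α => (UAct.lit α).dual) '' r.head

/-- The non-updatable literals of `r`. -/
def AIC.nup (r : AIC At) : Set (Lit At) := r.body \ r.up

/-- `lit` of a set of update actions. -/
def litSet (U : Set (UAct At)) : Set (Lit At) := UAct.lit '' U

/-- `U` is closed under the aic `r`. -/
def closedUnder (U : Set (UAct At)) (r : AIC At) : Prop :=
  r.nup ⊆ litSet U → (r.head ∩ U).Nonempty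

/-- `U` is closed under the set `η` of aics. -/
def closedUnderSet (U : Set (UAct At)) (η : Set (AIC At)) : Prop :=
  ∀ r ∈ η, closedUnder U r

/-- `U` is a justified action set for `⟨I,η⟩`: `U` is consistent and is a minimal
set of update actions containing `ne(I, I∘U)` and closed under `η`. -/
def justifiedActionSet (I : Set At) (η : Set (AIC At)) (U : Set (UAct At)) : Prop :=
  consistentActs U ∧
  noEffect I (applyActs I U) ⊆ U ∧
  closedUnderSet U η ∧
  ∀ U' : Set (UAct At),
    noEffect I (applyActs I U) ⊆ U' → closedUnderSet U' η → U' ⊆ U → U' = U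

/-- `E` is a justified weak repair for `⟨I,η⟩`. -/
def justifiedWeakRepair (I : Set At) (η : Set (AIC At)) (E : Set (UAct At)) : Prop :=
  ∃ U : Set (UAct At), justifiedActionSet I η U ∧ E = U \ noEffect I (applyActs I U)

/-- `E` is a justified repair for `⟨I,η⟩`. -/
def justifiedRepair (I : Set At) (η : Set (AIC At)) (E : Set (UAct At)) : Prop :=
  justifiedWeakRepair I η E ∧ ∀ E' ⊆ E, satAICs (applyActs I E') η → E' = E

/-- `U` is a weak repair for `⟨I,η⟩`. -/
def weakRepair (I : Set At) (η : Set (AIC At)) (U : Set (UAct At)) : Prop :=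
  consistentActs U ∧
  (UAct.add '' I ∪ UAct.del '' Iᶜ) ∩ U = ∅ ∧
  satAICs (applyActs I U) η

/-- `U` is a repair for `⟨I,η⟩`. -/
def repair (I : Set At) (η : Set (AIC At)) (U : Set (UAct At)) : Prop :=
  weakRepair I η U ∧ ∀ U' ⊆ U, satAICs (applyActs I U') η → U' = U

/-- The update action `α` is founded w.r.t. `⟨I,η⟩` and `U`. -/
def foundedAct (I : Set At) (η : Set (AIC At)) (U : Set (UAct At)) (α : UAct At) : Prop :=
  ∃ r ∈ η, α ∈ r.head ∧ entailsSet (applyActs I U) r.nup ∧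
    ∀ β ∈ r.head \ {α}, entails (applyActs I U) (UAct.lit β).dual

/-- `U` is founded w.r.t. `⟨I,η⟩`. -/
def foundedSet (I : Set At) (η : Set (AIC At)) (U : Set (UAct At)) : Prop :=
  ∀ α ∈ U, foundedAct I η U α

/-- Founded weak repair. -/
def foundedWeakRepair (I : Set At) (η : Set (AIC At)) (U : Set (UAct At)) : Prop :=
  weakRepair I η U ∧ foundedSet I η U

/-- Founded repair. -/
def foundedRepair (I : Set At) (η : Set (AIC At)) (U : Set (UAct At)) : Prop :=
  repair I η U ∧ foundedSet I η U

/-- An aic is normal if its head has at most one update action. -/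
def AIC.normal (r : AIC At) : Prop := r.head.Subsingleton

/-- The normalization `η^n` of a set of aics. -/
def normSet (η : Set (AIC At)) : Set (AIC At) :=
  {s | ∃ r ∈ η, ∃ α ∈ r.head, s.body = r.body ∧ s.head = {α}}

/- ===== disjunctive logic programs ===== -/

/-- A disjunctive logic program rule `a₁|…|a_k ← β`. -/
structure DRule (At : Type*) where
  head : Set At
  body : Set (Lit At)

/-- A rule is simple: no atom occurs twice in it. -/
def DRule.simple (ρ : DRule At) : Prop :=
  (∀ a ∈ ρ.head, Lit.pos a ∉ ρ.body ∧ Lit.neg a ∉ ρ.body) ∧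
  ∀ a : At, ¬ (Lit.pos a ∈ ρ.body ∧ Lit.neg a ∈ ρ.body)

/-- `M'` is a model of the reduct `P^M`. -/
def modelOfReduct (P : Set (DRule At)) (M M' : Set At) : Prop :=
  ∀ ρ ∈ P, (∀ a : At, Lit.neg a ∈ ρ.body → a ∉ M) →
    {a | Lit.pos a ∈ ρ.body} ⊆ M' → (ρ.head ∩ M').Nonempty

/-- `M` is an answer set of `P`: a minimal model of the reduct `P^M`. -/
def answerSet (P : Set (DRule At)) (M : Set At) : Prop :=
  modelOfReduct P M M ∧ ∀ M' ⊆ M, modelOfReduct P M M' → M' = M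

/-- `aic(ρ) = not a₁,…,not a_k, β ⊃ +a₁|…|+a_k`. -/
def aicOfRule (ρ : DRule At) : AIC At :=
  ⟨Lit.neg '' ρ.head ∪ ρ.body, UAct.add '' ρ.head, by
    rintro α ⟨a, ha, rfl⟩
    exact Set.mem_union_left _ ⟨a, ha, rfl⟩⟩

def aicOfProg (P : Set (DRule At)) : Set (AIC At) := aicOfRule '' P

/- ===== revision programming ===== -/

/-- Revision literals `in(a)` and `out(a)`. -/
inductive RLit (At : Type*) where
  | inn : At → RLit At
  | out : At → RLit At

namespace RLit
variable {At : Type*}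
def dual : RLit At → RLit At
  | inn a => out a
  | out a => inn a
def toLit : RLit At → Lit At
  | inn a => .pos a
  | out a => .neg a
def ua : RLit At → UAct At
  | inn a => .add a
  | out a => .del a
end RLit

def consistentRLits (U : Set (RLit At)) : Prop :=
  ∀ a : At, ¬ (RLit.inn a ∈ U ∧ RLit.out a ∈ U)

/-- `I ⊕ U`. -/
def applyRLits (I : Set At) (U : Set (RLit At)) : Set At :=
  (I ∪ {a | RLit.inn a ∈ U}) \ {a | RLit.out a ∈ U}

/-- A database satisfies a revision literal. -/
def satR (I : Set At) : RLit At → Prop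
  | .inn a => a ∈ I
  | .out a => a ∉ I

/-- A revision rule `α₁|…|α_k ← β₁,…,β_m` with `k+m ≥ 1`. -/
structure RRule (At : Type*) where
  head : Set (RLit At)
  body : Set (RLit At)
  hne : (head ∪ body).Nonempty

/-- `I` satisfies a revision rule. -/
def satRRule (I : Set At) (r : RRule At) : Prop :=
  (∀ β ∈ r.body, satR I β) → ∃ α ∈ r.head, satR I α

def satRProg (I : Set At) (P : Set (RRule At)) : Prop := ∀ r ∈ P, satRRule I r

/-- The inertia set `I(I,R)`. -/
def inertia (I R : Set At) : Set (RLit At) :=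
  RLit.inn '' (I ∩ R) ∪ RLit.out '' (I ∪ R)ᶜ

/-- A revision literal viewed as a revision rule with singleton head and empty body. -/
def RLit.toRule (α : RLit At) : RRule At := ⟨{α}, ∅, by simp⟩

def weakRevision (P : Set (RRule At)) (I : Set At) (U : Set (RLit At)) : Prop :=
  consistentRLits U ∧ U ∩ inertia I (applyRLits I U) = ∅ ∧ satRProg (applyRLits I U) P

def revision (P : Set (RRule At)) (I : Set At) (U : Set (RLit At)) : Prop :=
  weakRevision P I U ∧ ∀ U' ⊆ U, satRProg (applyRLits I U') P → U' = U

/-- `U` is closed under a revision program. -/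
def closedRev (U : Set (RLit At)) (P : Set (RRule At)) : Prop :=
  ∀ r ∈ P, r.body ⊆ U → (r.head ∩ U).Nonempty

/-- `U` is a P-justified update for `I`: a consistent minimal set closed under
`P ∪ I(I, I⊕U)`. -/
def justifiedUpdate (P : Set (RRule At)) (I : Set At) (U : Set (RLit At)) : Prop :=
  consistentRLits U ∧
  closedRev U (P ∪ RLit.toRule '' inertia I (applyRLits I U)) ∧
  ∀ U' ⊆ U, closedRev U' (P ∪ RLit.toRule '' inertia I (applyRLits I U)) → U' = U

def justifiedWeakRevision (P : Set (RRule At)) (I : Set At) (E : Set (RLit At)) : Prop :=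
  ∃ U : Set (RLit At), justifiedUpdate P I U ∧ E = U \ inertia I (applyRLits I U)

def justifiedRevision (P : Set (RRule At)) (I : Set At) (E : Set (RLit At)) : Prop :=
  justifiedWeakRevision P I E ∧ ∀ E' ⊆ E, satRProg (applyRLits I E') P → E' = E

def foundedRLit (P : Set (RRule At)) (I : Set At) (E : Set (RLit At)) (α : RLit At) : Prop :=
  ∃ r ∈ P, α ∈ r.head ∧ (∀ β ∈ r.body, satR (applyRLits I E) β) ∧
    ∀ β ∈ r.head \ {α}, satR (applyRLits I E) β.dual

def foundedRevSet (P : Set (RRule At)) (I : Set At) (E : Set (RLit At)) : Prop :=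
  ∀ α ∈ E, foundedRLit P I E α

def foundedWeakRevision (P : Set (RRule At)) (I : Set At) (E : Set (RLit At)) : Prop :=
  weakRevision P I E ∧ foundedRevSet P I E

def foundedRevision (P : Set (RRule At)) (I : Set At) (E : Set (RLit At)) : Prop :=
  revision P I E ∧ foundedRevSet P I E

/-- A revision program is normal if every head has at most one literal. -/
def normalRProg (P : Set (RRule At)) : Prop := ∀ r ∈ P, r.head.Subsingleton

/-- `head(P_R)`: heads of the rules of `P` whose bodies are satisfied by `R`. -/
def headsOfFired (P : Set (RRule At)) (R : Set At) : Set (RLit At) :=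
  {α | ∃ r ∈ P, (∀ β ∈ r.body, satR R β) ∧ α ∈ r.head}

def supportedUpdate (P : Set (RRule At)) (I : Set At) (U : Set (RLit At)) : Prop :=
  consistentRLits U ∧ U = headsOfFired P (applyRLits I U)

def supportedRevision (P : Set (RRule At)) (I : Set At) (E : Set (RLit At)) : Prop :=
  ∃ U : Set (RLit At), supportedUpdate P I U ∧ E = U \ inertia I (applyRLits I U)

/-- A revision program is proper: no head literal is dual of a body literal. -/
def properRProg (P : Set (RRule At)) : Prop :=
  ∀ r ∈ P, ∀ α ∈ r.head, α.dual ∉ r.body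

/-- `AIC(r)` for a revision rule `r`. -/
def AICofRRule (r : RRule At) : AIC At :=
  ⟨RLit.toLit '' r.body ∪ (fun α => (RLit.toLit α).dual) '' r.head,
   RLit.ua '' r.head, by
    rintro α ⟨β, hβ, rfl⟩
    refine Set.mem_union_right _ ⟨β, hβ, ?_⟩
    cases β <;> rfl⟩

def AICofProg (P : Set (RRule At)) : Set (AIC At) := AICofRRule '' P

/-- `ua` extended to sets of revision literals. -/
def uaSet (E : Set (RLit At)) : Set (UAct At) := RLit.ua '' E

/- ===== shifting ===== -/

open Classical in
/-- `T_W` on update actions. -/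
noncomputable def TWu (W : Set At) (α : UAct At) : UAct At :=
  if α.atom ∈ W then α.dual else α

open Classical in
/-- `T_W` on literals. -/
noncomputable def TWl (W : Set At) (L : Lit At) : Lit At :=
  if L.atom ∈ W then L.dual else L

lemma TW_lit_dual (W : Set At) (α : UAct At) :
    (UAct.lit (TWu W α)).dual = TWl W ((UAct.lit α).dual) := by
  unfold TWu TWl
  by_cases h : α.atom ∈ W <;> cases α <;>
    simp_all [UAct.dual, UAct.lit, UAct.atom, Lit.dual, Lit.atom]

/-- `T_W` on active integrity constraints. -/
noncomputable def TWaic (W : Set At) (r : AIC At) : AIC At :=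
  ⟨TWl W '' r.body, TWu W '' r.head, by
    rintro α ⟨β, hβ, rfl⟩
    rw [TW_lit_dual]
    exact ⟨_, r.hua β hβ, rfl⟩⟩

/-- A database entails an update action: `+a` iff `a ∈ I`, `−a` iff `a ∉ I`. -/
def entailsU (I : Set At) : UAct At → Prop
  | .add a => a ∈ I
  | .del a => a ∉ I

lemma TWu_invol (W : Set At) (α : UAct At) : TWu W (TWu W α) = α := by
  unfold TWu
  by_cases h : α.atom ∈ W <;> cases α <;> simp_all [UAct.dual, UAct.atom]

lemma mem_TWu_image (W : Set At) (U : Set (UAct At)) (α : UAct At) :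
    α ∈ TWu W '' U ↔ TWu W α ∈ U := by
  constructor
  · rintro ⟨β, hβ, rfl⟩
    rwa [TWu_invol]
  · intro hα
    exact ⟨_, hα, TWu_invol W α⟩

theorem statement16 {At : Type*} [Fintype At] (I W : Set At) (U : Set (UAct At))
    (h : consistentActs U) :
    symmDiff (applyActs I U) W = applyActs (symmDiff I W) (TWu W '' U) := by
  ext a
  have ha := h a
  simp only [applyActs, Set.mem_symmDiff, Set.mem_diff, Set.mem_union, Set.mem_setOf_eq,
    mem_TWu_image]
  by_cases hW : a ∈ W
  · have h1 : TWu W (UAct.add a) = UAct.del a := by simp [TWu, UAct.atom, UAct.dual, hW]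
    have h2 : TWu W (UAct.del a) = UAct.add a := by simp [TWu, UAct.atom, UAct.dual, hW]
    rw [h1, h2]
    tauto
  · have h1 : TWu W (UAct.add a) = UAct.add a := by simp [TWu, UAct.atom, hW]
    have h2 : TWu W (UAct.del a) = UAct.del a := by simp [TWu, UAct.atom, hW]
    rw [h1, h2]
    tauto

end AICF
end

section
/- Let I and W be databases. For every set η of active integrity constraints and every set U of update actions, U is a justified action set for ⟨I,η⟩ if and only if T_W(U) is a justified action set for ⟨I △ W, T_W(η)⟩, where △ denotes symmetric difference. -/
namespace AICF

variable {At : Type*}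

lemma TWl_invol (W : Set At) (L : Lit At) : TWl W (TWl W L) = L := by
  unfold TWl
  by_cases h : L.atom ∈ W <;> cases L <;> simp_all [Lit.dual, Lit.atom]

lemma TWu_lit (W : Set At) (α : UAct At) : UAct.lit (TWu W α) = TWl W (UAct.lit α) := by
  unfold TWu TWl
  by_cases h : α.atom ∈ W <;> cases α <;>
    simp_all [UAct.dual, UAct.lit, UAct.atom, Lit.dual, Lit.atom]

lemma TWu_inj (W : Set At) : Function.Injective (TWu W) :=
  Function.LeftInverse.injective (TWu_invol W)

lemma TWl_inj (W : Set At) : Function.Injective (TWl W) :=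
  Function.LeftInverse.injective (TWl_invol W)

lemma TWu_add (W : Set At) (a : At) :
    (a ∈ W → TWu W (.add a) = .del a) ∧ (a ∉ W → TWu W (.add a) = .add a) := by
  constructor <;> intro h <;> simp [TWu, UAct.atom, UAct.dual, h]

lemma TWu_del (W : Set At) (a : At) :
    (a ∈ W → TWu W (.del a) = .add a) ∧ (a ∉ W → TWu W (.del a) = .del a) := by
  constructor <;> intro h <;> simp [TWu, UAct.atom, UAct.dual, h]

lemma consistent_TW (W : Set At) (U : Set (UAct At)) :
    consistentActs (TWu W '' U) ↔ consistentActs U := by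
  unfold consistentActs
  refine forall_congr' fun a => ?_
  rw [mem_TWu_image, mem_TWu_image]
  by_cases h : a ∈ W
  · rw [(TWu_add W a).1 h, (TWu_del W a).1 h, and_comm]
  · rw [(TWu_add W a).2 h, (TWu_del W a).2 h]

lemma apply_TW (I W : Set At) (U : Set (UAct At)) (hU : consistentActs U) :
    applyActs (symmDiff I W) (TWu W '' U) = symmDiff (applyActs I U) W := by
  ext a
  have hc := hU a
  simp only [applyActs, Set.mem_diff, Set.mem_union, Set.mem_setOf_eq, Set.mem_symmDiff,
    mem_TWu_image]
  by_cases h : a ∈ W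
  · rw [(TWu_add W a).1 h, (TWu_del W a).1 h]
    tauto
  · rw [(TWu_add W a).2 h, (TWu_del W a).2 h]
    tauto

lemma add_mem_noEffect (I R : Set At) (a : At) :
    UAct.add a ∈ noEffect I R ↔ a ∈ I ∧ a ∈ R := by
  simp [noEffect]

lemma del_mem_noEffect (I R : Set At) (a : At) :
    UAct.del a ∈ noEffect I R ↔ a ∉ I ∧ a ∉ R := by
  simp [noEffect]

lemma noEffect_TW (I R W : Set At) :
    noEffect (symmDiff I W) (symmDiff R W) = TWu W '' noEffect I R := by
  ext α
  rw [mem_TWu_image]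
  cases α with
  | add a =>
    by_cases h : a ∈ W
    · rw [(TWu_add W a).1 h, add_mem_noEffect, del_mem_noEffect]
      simp only [Set.mem_symmDiff]
      tauto
    · rw [(TWu_add W a).2 h, add_mem_noEffect, add_mem_noEffect]
      simp only [Set.mem_symmDiff]
      tauto
  | del a =>
    by_cases h : a ∈ W
    · rw [(TWu_del W a).1 h, add_mem_noEffect, del_mem_noEffect]
      simp only [Set.mem_symmDiff]
      tauto
    · rw [(TWu_del W a).2 h, del_mem_noEffect, del_mem_noEffect]
      simp only [Set.mem_symmDiff]
      tauto

lemma nup_TW (W : Set At) (r : AIC At) : (TWaic W r).nup = TWl W '' r.nup := by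
  unfold AIC.nup
  rw [Set.image_diff (TWl_inj W)]
  congr 1
  simp only [AIC.up, TWaic, Set.image_image, TW_lit_dual]

lemma litSet_TW (W : Set At) (U : Set (UAct At)) :
    litSet (TWu W '' U) = TWl W '' litSet U := by
  simp only [litSet, Set.image_image, TWu_lit]

lemma closedUnder_TW (W : Set At) (U : Set (UAct At)) (r : AIC At) :
    closedUnder (TWu W '' U) (TWaic W r) ↔ closedUnder U r := by
  unfold closedUnder
  rw [nup_TW, litSet_TW, Set.image_subset_image_iff (TWl_inj W)]
  have : (TWaic W r).head = TWu W '' r.head := rfl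
  rw [this, ← Set.image_inter (TWu_inj W), Set.image_nonempty]

lemma closedUnderSet_TW (W : Set At) (U : Set (UAct At)) (η : Set (AIC At)) :
    closedUnderSet (TWu W '' U) (TWaic W '' η) ↔ closedUnderSet U η := by
  unfold closedUnderSet
  rw [Set.forall_mem_image]
  simp only [closedUnder_TW]

theorem statement18 {At : Type*} [Fintype At] (I W : Set At) (η : Set (AIC At))
    (U : Set (UAct At)) :
    justifiedActionSet I η U ↔
      justifiedActionSet (symmDiff I W) (TWaic W '' η) (TWu W '' U) := by
  unfold justifiedActionSet
  rw [consistent_TW]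
  refine and_congr_right fun hU => ?_
  rw [apply_TW I W U hU, noEffect_TW, Set.image_subset_image_iff (TWu_inj W), closedUnderSet_TW]
  refine and_congr_right fun _ => and_congr_right fun _ => ?_
  have hs : Function.Surjective (fun V : Set (UAct At) => TWu W '' V) :=
    Set.image_surjective.2 (Function.RightInverse.surjective (TWu_invol W))
  refine Iff.trans ?_ hs.forall.symm
  refine forall_congr' fun V => ?_
  beta_reduce
  rw [Set.image_subset_image_iff (TWu_inj W), closedUnderSet_TW,
    Set.image_subset_image_iff (TWu_inj W), (Set.image_injective.2 (TWu_inj W)).eq_iff]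

end AICF
end
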